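/- CFL ∩ co-CFL is not contained in DCFL(ω) ∪ DCFL[ω]: there exists a language L such that both L and its complement are context-free, yet L belongs to neither DCFL(d) nor DCFL[d] for any integer d ≥ 1. -/

import Mathlib

/-!
Formalization of one-way deterministic pushdown automata (1dpda) following
Yamakami, "Intersection and Union Hierarchies of Deterministic Context-Free
Languages and Pumping Lemmas".
-/

namespace DCFLFormal

/-- Tape symbols: the left endmarker ¢, the right endmarker $, and input symbols. -/
inductive TSym (α : Type) : Type
  | lend : TSym α
  | rend : TSym α
  | ch : α → TSym α

/-- A one-way deterministic pushdown automaton (1dpda).  `δ q (some t) a` is the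
transition reading the tape symbol `t` with top stack symbol `a`; `δ q none a`
is the ε-transition.  The value `some (p, w)` means: change state to `p` and
replace the topmost stack symbol by the string `w`. -/
structure DPDA (Q α Γ : Type) where
  δ : Q → Option (TSym α) → Γ → Option (Q × List Γ)
  q0 : Q
  Z0 : Γ
  Acc : Set Q
  Rej : Set Q

/-- A configuration: current state, remaining (unread) tape, and stack content
(topmost symbol first, the bottom marker last). -/
structure Cfg (Q α Γ : Type) where
  st : Q
  inp : List (TSym α)
  stk : List Γ

namespace DPDA

variable {Q α Γ : Type}

/-- Halting (accepting or rejecting) states. -/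
def IsHalting (M : DPDA Q α Γ) (q : Q) : Prop := q ∈ M.Acc ∨ q ∈ M.Rej

/-- One step of the machine: an ε-move if one is defined, otherwise read the
next tape symbol; the head moves right exactly when a tape symbol is read. -/
def step (M : DPDA Q α Γ) (c : Cfg Q α Γ) : Option (Cfg Q α Γ) :=
  match c.stk with
  | [] => none
  | a :: s =>
    match M.δ c.st none a with
    | some (p, w) => some ⟨p, c.inp, w ++ s⟩
    | none =>
      match c.inp with
      | [] => none
      | t :: rest =>
        match M.δ c.st (some t) a with
        | some (p, w) => some ⟨p, rest, w ++ s⟩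
        | none => none

/-- Iterated steps. -/
def stepN (M : DPDA Q α Γ) : ℕ → Cfg Q α Γ → Option (Cfg Q α Γ)
  | 0, c => some c
  | n + 1, c => (M.step c).bind (M.stepN n)

/-- The tape holding ¢ x $. -/
def tape (x : List α) : List (TSym α) :=
  TSym.lend :: x.map TSym.ch ++ [TSym.rend]

/-- The initial configuration on input `x`. -/
def init (M : DPDA Q α Γ) (x : List α) : Cfg Q α Γ := ⟨M.q0, tape x, [M.Z0]⟩

/-- `M` accepts `x`: the computation reaches an accepting state. -/
def Accepts (M : DPDA Q α Γ) (x : List α) : Prop :=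
  ∃ n c, M.stepN n (M.init x) = some c ∧ c.st ∈ M.Acc

/-- `M` rejects `x`: the computation reaches a rejecting state. -/
def Rejects (M : DPDA Q α Γ) (x : List α) : Prop :=
  ∃ n c, M.stepN n (M.init x) = some c ∧ c.st ∈ M.Rej

/-- `M` halts (in an accepting or rejecting state) on every input. -/
def HaltsOnAll (M : DPDA Q α Γ) : Prop :=
  ∀ x : List α, ∃ n c, M.stepN n (M.init x) = some c ∧ M.IsHalting c.st

/-- The language recognized by `M`. -/
def lang (M : DPDA Q α Γ) : Set (List α) := {x | M.Accepts x}

/-- Well-formedness of a 1dpda: accepting and rejecting states are disjoint,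
halting states have no outgoing transitions, for every non-halting state,
stack symbol and (non-empty) tape symbol exactly one of the symbol- and the
ε-transition is defined, and the bottom marker Z₀ is never removed. -/
def Valid (M : DPDA Q α Γ) : Prop :=
  (∀ q, q ∈ M.Acc → q ∉ M.Rej) ∧
  (∀ q, M.IsHalting q → ∀ σ a, M.δ q σ a = none) ∧
  (∀ q, ¬ M.IsHalting q → ∀ σ a, ((M.δ q (some σ) a).isSome ↔ M.δ q none a = none)) ∧
  (∀ q σ p w, M.δ q σ M.Z0 = some (p, w) → w ≠ [])

end DPDA

/-- A language is deterministic context-free if it is recognized by some 1dpda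
(with finitely many states and stack symbols) that halts on all inputs. -/
def IsDCFL {α : Type} (L : Set (List α)) : Prop :=
  ∃ (Q Γ : Type) (_ : Fintype Q) (_ : Fintype Γ) (M : DPDA Q α Γ),
    M.Valid ∧ M.HaltsOnAll ∧ L = M.lang

/-- `DCFL(d)`: intersections of `d` dcf languages. -/
def DCFLInter {α : Type} (d : ℕ) (L : Set (List α)) : Prop :=
  ∃ f : Fin d → Set (List α), (∀ i, IsDCFL (f i)) ∧ L = ⋂ i, f i

/-- `DCFL[d]`: unions of `d` dcf languages. -/
def DCFLUnion {α : Type} (d : ℕ) (L : Set (List α)) : Prop :=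
  ∃ f : Fin d → Set (List α), (∀ i, IsDCFL (f i)) ∧ L = ⋃ i, f i

/-- `rep x i` is the string `x` repeated `i` times. -/
def rep {α : Type} (x : List α) (i : ℕ) : List α := (List.replicate i x).flatten

/-- `(x, y)` is an iterative pair of the string `u ++ x ++ v ++ y ++ z` for `L`. -/
def IterPair {α : Type} (L : Set (List α)) (u x v y z : List α) : Prop :=
  1 ≤ (x ++ y).length ∧ ∀ i : ℕ, u ++ rep x i ++ v ++ rep y i ++ z ∈ L

/-- A nondegenerate iterative pair: either `{u xⁱ v yʲ z ∈ L : j ≥ 0}` is finite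
for each `i`, or `{u xⁱ v yʲ z ∈ L : i ≥ 0}` is finite for each `j`. -/
def NonDegIterPair {α : Type} (L : Set (List α)) (u x v y z : List α) : Prop :=
  IterPair L u x v y z ∧
  ((∀ i : ℕ, {s | s ∈ L ∧ ∃ j : ℕ, s = u ++ rep x i ++ v ++ rep y j ++ z}.Finite) ∨
   (∀ j : ℕ, {s | s ∈ L ∧ ∃ i : ℕ, s = u ++ rep x i ++ v ++ rep y j ++ z}.Finite))

namespace DPDA

variable {Q α Γ : Type} {M : DPDA Q α Γ}

/-- `M` moves from one configuration to another in finitely many steps. -/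
def Reaches (M : DPDA Q α Γ) : Cfg Q α Γ → Cfg Q α Γ → Prop :=
  Relation.ReflTransGen fun c d => M.step c = some d

theorem reaches_iff_exists_stepN {c d : Cfg Q α Γ} :
    M.Reaches c d ↔ ∃ n, M.stepN n c = some d := by
  constructor
  · intro h
    induction h using Relation.ReflTransGen.head_induction_on with
    | refl => exact ⟨0, rfl⟩
    | head h _ ih =>
      obtain ⟨n, hn⟩ := ih
      exact ⟨n + 1, by simp [stepN, h, hn]⟩
  · rintro ⟨n, hn⟩
    induction n generalizing c with
    | zero =>
      obtain rfl : c = d := by simpa [stepN] using hn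
      exact Relation.ReflTransGen.refl
    | succ n ih =>
      obtain ⟨e, he, hed⟩ : ∃ e, M.step c = some e ∧ M.stepN n e = some d := by
        simpa [stepN, Option.bind_eq_some_iff] using hn
      exact Relation.ReflTransGen.head he (ih hed)

/-- `M` reaches an accepting state from the configuration `c`. -/
def AcceptsFrom (M : DPDA Q α Γ) (c : Cfg Q α Γ) : Prop :=
  ∃ d, M.Reaches c d ∧ d.st ∈ M.Acc

theorem accepts_iff {x : List α} : M.Accepts x ↔ M.AcceptsFrom (M.init x) := by
  simp only [Accepts, AcceptsFrom, reaches_iff_exists_stepN]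
  exact ⟨fun ⟨n, c, h, hc⟩ => ⟨c, ⟨n, h⟩, hc⟩, fun ⟨c, ⟨n, h⟩, hc⟩ => ⟨n, c, h, hc⟩⟩

theorem Reaches.total {c d e : Cfg Q α Γ} (hd : M.Reaches c d) (he : M.Reaches c e) :
    M.Reaches d e ∨ M.Reaches e d :=
  Relation.ReflTransGen.total_of_right_unique
    (fun _ _ _ h h' => Option.some.inj (h.symm.trans h')) hd he

theorem AcceptsFrom.of_reaches {c d : Cfg Q α Γ} (h : M.Reaches c d) (hd : M.AcceptsFrom d) :
    M.AcceptsFrom c :=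
  let ⟨e, he, hacc⟩ := hd
  ⟨e, Relation.ReflTransGen.trans h he, hacc⟩

theorem Reaches.eq_of_step_eq_none {c d : Cfg Q α Γ} (h : M.Reaches c d)
    (hc : M.step c = none) : d = c := by
  rcases Relation.ReflTransGen.cases_head h with h | ⟨e, he, -⟩
  · exact h.symm
  · simp [hc] at he

theorem Valid.step_eq_none (hM : M.Valid) {c : Cfg Q α Γ} (hc : M.IsHalting c.st) :
    M.step c = none := by
  obtain ⟨q, i, s⟩ := c
  have h := hM.2.1 q hc
  rcases s with _ | ⟨a, s⟩
  · rfl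
  · rcases i with _ | ⟨t, i⟩ <;> simp [step, h]

theorem AcceptsFrom.of_reaches_left (hM : M.Valid) {c d : Cfg Q α Γ} (hc : M.AcceptsFrom c)
    (h : M.Reaches c d) : M.AcceptsFrom d := by
  obtain ⟨e, he, hacc⟩ := hc
  rcases h.total he with h | h
  · exact ⟨e, h, hacc⟩
  · obtain rfl := h.eq_of_step_eq_none (hM.step_eq_none (Or.inl hacc))
    exact ⟨d, Relation.ReflTransGen.refl, hacc⟩

/-- A step consumes a prefix of the input, of length at most one, and does not depend on what
follows that prefix. -/
theorem exists_prefix_of_step {c d : Cfg Q α Γ} (h : M.step c = some d) :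
    ∃ pre, pre.length ≤ 1 ∧ c.inp = pre ++ d.inp ∧
      ∀ r, M.step ⟨c.st, pre ++ r, c.stk⟩ = some ⟨d.st, r, d.stk⟩ := by
  obtain ⟨q, i, s⟩ := c
  rcases s with _ | ⟨a, s⟩
  · simp [step] at h
  rcases hε : M.δ q none a with _ | ⟨p, w⟩
  · rcases i with _ | ⟨t, i⟩
    · simp [step, hε] at h
    rcases ht : M.δ q (some t) a with _ | ⟨p, w⟩
    · simp [step, hε, ht] at h
    obtain rfl : _ = d := by simpa [step, hε, ht] using h
    exact ⟨[t], by simp, rfl, fun r => by simp [step, hε, ht]⟩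
  · obtain rfl : _ = d := by simpa [step, hε] using h
    exact ⟨[], by simp, rfl, fun r => by simp [step, hε]⟩

theorem Reaches.exists_prefix {c d : Cfg Q α Γ} (h : M.Reaches c d) :
    ∃ pre, c.inp = pre ++ d.inp ∧
      ∀ r, M.Reaches ⟨c.st, pre ++ r, c.stk⟩ ⟨d.st, r, d.stk⟩ := by
  induction h using Relation.ReflTransGen.head_induction_on with
  | refl => exact ⟨[], rfl, fun r => Relation.ReflTransGen.refl⟩
  | head h _ ih =>
    obtain ⟨p₁, -, e₁, h₁⟩ := exists_prefix_of_step h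
    obtain ⟨p₂, e₂, h₂⟩ := ih
    refine ⟨p₁ ++ p₂, by simp [e₁, e₂], fun r => ?_⟩
    rw [List.append_assoc]
    exact Relation.ReflTransGen.head (h₁ _) (h₂ r)

theorem Reaches.append {q p : Q} {i j : List (TSym α)} {s t : List Γ}
    (h : M.Reaches ⟨q, i, s⟩ ⟨p, j, t⟩) (r : List (TSym α)) :
    M.Reaches ⟨q, i ++ r, s⟩ ⟨p, j ++ r, t⟩ := by
  obtain ⟨pre, hi, hr⟩ := h.exists_prefix
  simp only at hi
  subst hi
  simpa using hr (j ++ r)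

/-- The head passes over every position: a computation either leaves the final part `t` of the
input untouched or reaches a configuration in which exactly `t` is left. -/
theorem Reaches.exists_suffix_or {c d : Cfg Q α Γ} (h : M.Reaches c d) (t : List (TSym α)) :
    ∀ i, c.inp = i ++ t → (∃ r, d.inp = r ++ t) ∨ ∃ q s, M.Reaches c ⟨q, t, s⟩ := by
  induction h with
  | refl => exact fun i hi => Or.inl ⟨i, hi⟩
  | @tail b d hcb hbd ih =>
    intro i hi
    rcases ih i hi with ⟨r, hr⟩ | h
    · obtain ⟨pre, hlen, e, -⟩ := exists_prefix_of_step hbd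
      rcases r with _ | ⟨a, r⟩
      · right
        refine ⟨b.st, b.stk, ?_⟩
        rw [List.nil_append] at hr
        subst hr
        exact hcb
      · left
        rcases pre with _ | ⟨a', pre⟩
        · exact ⟨a :: r, by simpa [hr] using e.symm⟩
        · obtain rfl : pre = [] := by simpa using hlen
          rw [hr] at e
          simp only [List.cons_append, List.nil_append, List.cons.injEq] at e
          exact ⟨r, e.2.symm⟩
    · exact Or.inr h

/-- If a computation uncovers the bottom part `s₁` of its stack only when its input is exhausted,
then `s₁` may be replaced by any `s₂` that accepts from the same states on exhausted input. -/
theorem AcceptsFrom.replace_bottom {s₁ s₂ : List Γ}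
    (hs : ∀ p, M.AcceptsFrom ⟨p, [], s₁⟩ → M.AcceptsFrom ⟨p, [], s₂⟩) {q : Q}
    {i : List (TSym α)} {t : List Γ} (h : M.AcceptsFrom ⟨q, i, t ++ s₁⟩)
    (hmin : ∀ p j, M.Reaches ⟨q, i, t ++ s₁⟩ ⟨p, j, s₁⟩ → j = []) :
    M.AcceptsFrom ⟨q, i, t ++ s₂⟩ := by
  obtain ⟨d, hd, hacc⟩ := h
  generalize hc : (⟨q, i, t ++ s₁⟩ : Cfg Q α Γ) = c at hd hmin
  induction hd using Relation.ReflTransGen.head_induction_on generalizing q i t with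
  | refl => exact ⟨⟨q, i, t ++ s₂⟩, Relation.ReflTransGen.refl, by simpa [← hc] using hacc⟩
  | @head c e hce hed ih =>
    subst hc
    rcases t with _ | ⟨a, t⟩
    · obtain rfl : i = [] := hmin q i Relation.ReflTransGen.refl
      exact hs q ⟨d, Relation.ReflTransGen.head hce hed, hacc⟩
    · have key : ∃ p j t', e = ⟨p, j, t' ++ s₁⟩ ∧
          M.step ⟨q, i, a :: t ++ s₂⟩ = some ⟨p, j, t' ++ s₂⟩ := by
        rcases hε : M.δ q none a with _ | ⟨p, w⟩
        · rcases i with _ | ⟨b, i⟩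
          · simp [step, hε] at hce
          rcases hb : M.δ q (some b) a with _ | ⟨p, w⟩
          · simp [step, hε, hb] at hce
          · refine ⟨p, i, w ++ t, ?_, by simp [step, hε, hb]⟩
            simpa [step, hε, hb] using hce.symm
        · refine ⟨p, i, w ++ t, ?_, by simp [step, hε]⟩
          simpa [step, hε] using hce.symm
      obtain ⟨p, j, t', rfl, hstep⟩ := key
      refine AcceptsFrom.of_reaches (Relation.ReflTransGen.single hstep) (ih rfl ?_)
      exact fun p' j' h => hmin p' j' (Relation.ReflTransGen.head hce h)

/-- The configuration in which `M` starts on `x` without a right endmarker. -/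
def openInit (M : DPDA Q α Γ) (x : List α) : Cfg Q α Γ :=
  ⟨M.q0, TSym.lend :: x.map TSym.ch, [M.Z0]⟩

theorem Reaches.openInit_append {x : List α} {q : Q} {i : List (TSym α)} {s : List Γ}
    (h : M.Reaches (M.openInit x) ⟨q, i, s⟩) (z : List α) :
    M.Reaches (M.openInit (x ++ z)) ⟨q, i ++ z.map TSym.ch, s⟩ := by
  simpa [openInit] using h.append (z.map TSym.ch)

theorem Reaches.init_of_openInit {x : List α} {q : Q} {i : List (TSym α)} {s : List Γ}
    (h : M.Reaches (M.openInit x) ⟨q, i, s⟩) :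
    M.Reaches (M.init x) ⟨q, i ++ [TSym.rend], s⟩ := by
  simpa [openInit, init, tape] using h.append [TSym.rend]

theorem Valid.mem_lang_iff_of_reaches (hM : M.Valid) {c : Cfg Q α Γ} {x : List α}
    (h : M.Reaches (M.init x) c) : x ∈ M.lang ↔ M.AcceptsFrom c :=
  accepts_iff.trans ⟨fun hx => hx.of_reaches_left hM h, AcceptsFrom.of_reaches h⟩

theorem Valid.acceptsFrom_iff_of_isHalting (hM : M.Valid) {c : Cfg Q α Γ}
    (hc : M.IsHalting c.st) : M.AcceptsFrom c ↔ c.st ∈ M.Acc := by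
  refine ⟨?_, fun h => ⟨c, Relation.ReflTransGen.refl, h⟩⟩
  rintro ⟨d, hd, hacc⟩
  rwa [hd.eq_of_step_eq_none (hM.step_eq_none hc)] at hacc

theorem Valid.isHalting_of_reaches_nil (hM : M.Valid) (hH : M.HaltsOnAll) {x : List α} {q : Q}
    {i : List (TSym α)} (h : M.Reaches (M.openInit x) ⟨q, i, []⟩) : M.IsHalting q := by
  obtain ⟨n, c, hn, hc⟩ := hH x
  rcases h.init_of_openInit.total (reaches_iff_exists_stepN.2 ⟨n, hn⟩) with h | h
  · rwa [h.eq_of_step_eq_none rfl] at hc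
  · rwa [← h.eq_of_step_eq_none (hM.step_eq_none hc)] at hc

/-- On every input `M` either halts before reading the right endmarker, or it reaches the right
endmarker. -/
theorem HaltsOnAll.openInit_cases (hH : M.HaltsOnAll) (x : List α) :
    (∃ c, M.Reaches (M.openInit x) c ∧ M.IsHalting c.st) ∨
      ∃ q s, M.Reaches (M.openInit x) ⟨q, [], s⟩ := by
  obtain ⟨n, c, hn, hc⟩ := hH x
  have hr : M.Reaches (M.init x) c := reaches_iff_exists_stepN.2 ⟨n, hn⟩
  have cut : ∀ r q s, M.Reaches (M.init x) ⟨q, r ++ [TSym.rend], s⟩ →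
      M.Reaches (M.openInit x) ⟨q, r, s⟩ := by
    intro r q s h
    obtain ⟨pre, hpre, h⟩ := h.exists_prefix
    have e : TSym.lend :: x.map TSym.ch = pre ++ r := by
      refine List.append_cancel_right (bs := [TSym.rend]) ?_
      simpa [init, tape] using hpre
    simpa [openInit, init, e] using h r
  rcases hr.exists_suffix_or [TSym.rend] (TSym.lend :: x.map TSym.ch) rfl with
    ⟨r, hr'⟩ | ⟨q, s, hs⟩
  · exact Or.inl ⟨⟨c.st, r, c.stk⟩, cut r _ _ (by rw [← hr']; exact hr), hc⟩
  · exact Or.inr ⟨q, s, cut [] _ _ hs⟩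

end DPDA

/-- The words after which a dcf language has one of finitely many behaviours are cofinal: `R t`
consists of words after which the language behaves in the way `t`, and every word extends to a
word in some `R t`. -/
theorem IsDCFL.exists_finite_cofinal {α : Type} {L : Set (List α)} (hL : IsDCFL L) :
    ∃ (T : Type) (_ : Finite T) (R : T → Set (List α)),
      (∀ t, ∀ x ∈ R t, ∀ y ∈ R t, ∀ z, x ++ z ∈ L → y ++ z ∈ L) ∧
      ∀ u, ∃ v t, u ++ v ∈ R t := by
  obtain ⟨Q, Γ, _, _, M, hM, hH, rfl⟩ := hL
  refine ⟨Prop ⊕ Q × Γ × Set Q, inferInstance,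
    Sum.elim (fun b => {x | ∀ z, x ++ z ∈ M.lang ↔ b})
      (fun t => {x | ∃ s, M.Reaches (M.openInit x) ⟨t.1, [], t.2.1 :: s⟩ ∧
        (∀ z p s', M.Reaches (M.openInit (x ++ z)) ⟨p, [], s'⟩ → s.length < s'.length) ∧
        {p | M.AcceptsFrom ⟨p, [], s⟩} = t.2.2}), ?_, fun u => ?_⟩
  · rintro (b | ⟨q, a, F⟩) x hx y hy z hxz
    · exact (hy z).2 ((hx z).1 hxz)
    · obtain ⟨s₁, hx, hmin, hF₁⟩ := hx
      obtain ⟨s₂, hy, -, hF₂⟩ := hy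
      have hx' := hx.openInit_append z
      rw [hM.mem_lang_iff_of_reaches hx'.init_of_openInit] at hxz
      rw [hM.mem_lang_iff_of_reaches (hy.openInit_append z).init_of_openInit]
      refine DPDA.AcceptsFrom.replace_bottom (t := [a])
        (fun p hp => (hF₁.trans hF₂.symm).subset hp) hxz fun p j hj => ?_
      by_contra hne
      obtain ⟨j, b, rfl⟩ := List.eq_nil_or_concat' j |>.resolve_left hne
      obtain ⟨pre, hpre, hj⟩ := hj.exists_prefix
      have hpre : z.map TSym.ch = pre ++ j := by
        have := congrArg List.dropLast hpre
        simpa [← List.append_assoc] using this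
      obtain ⟨z₁, z₂, rfl, rfl, -⟩ := List.map_eq_append_iff.1 hpre
      have h : M.Reaches (M.openInit (x ++ z₁)) ⟨p, [], s₁⟩ :=
        Relation.ReflTransGen.trans (hx.openInit_append z₁) (by simpa [DPDA.Reaches] using hj [])
      exact lt_irrefl _ (hmin z₁ p s₁ h)
  · by_cases hhalt : ∃ v c, M.Reaches (M.openInit (u ++ v)) c ∧ M.IsHalting c.st
    · obtain ⟨v, c, hc, hcs⟩ := hhalt
      refine ⟨v, Sum.inl (c.st ∈ M.Acc), fun z => ?_⟩
      rw [hM.mem_lang_iff_of_reaches (hc.openInit_append z).init_of_openInit]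
      exact hM.acceptsFrom_iff_of_isHalting hcs
    · have hex : ∃ k v q s, M.Reaches (M.openInit (u ++ v)) ⟨q, [], s⟩ ∧ s.length = k := by
        obtain ⟨q, s, h⟩ := (hH.openInit_cases (u ++ [])).resolve_left fun h => hhalt ⟨[], h⟩
        exact ⟨_, [], q, s, h, rfl⟩
      classical
      obtain ⟨v, q, s, h, hlen⟩ := Nat.find_spec hex
      rcases s with _ | ⟨a, s⟩
      · exact (hhalt ⟨v, _, h, hM.isHalting_of_reaches_nil hH h⟩).elim
      · refine ⟨v, Sum.inr (q, a, _), s, h, fun z p s' h' => ?_, rfl⟩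
        have hle := Nat.find_min' hex ⟨v ++ z, p, s', by simpa using h', rfl⟩
        rw [← hlen] at hle
        simpa using hle

theorem IsDCFL.compl {α : Type} {L : Set (List α)} (hL : IsDCFL L) : IsDCFL Lᶜ := by
  obtain ⟨Q, Γ, hQ, hΓ, M, hM, hH, rfl⟩ := hL
  let M' : DPDA Q α Γ := { M with Acc := M.Rej, Rej := M.Acc }
  have hstep : ∀ n c, M'.stepN n c = M.stepN n c := by
    intro n
    induction n with
    | zero => exact fun _ => rfl
    | succ n ih => exact fun c => congrArg (M.step c).bind (funext ih)
  have hhalt : ∀ q, M'.IsHalting q ↔ M.IsHalting q := fun q => or_comm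
  have hM' : M'.Valid := ⟨fun q hq hq' => hM.1 q hq' hq, fun q hq => hM.2.1 q ((hhalt q).1 hq),
    fun q hq => hM.2.2.1 q (mt (hhalt q).2 hq), hM.2.2.2⟩
  refine ⟨Q, Γ, hQ, hΓ, M', hM', fun x => ?_, Set.ext fun x => ?_⟩
  · obtain ⟨n, c, hn, hc⟩ := hH x
    exact ⟨n, c, (hstep n _).trans hn, (hhalt _).2 hc⟩
  · obtain ⟨n, c, hn, hc⟩ := hH x
    have hr : M.Reaches (M.init x) c := DPDA.reaches_iff_exists_stepN.2 ⟨n, hn⟩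
    have hr' : M'.Reaches (M'.init x) c :=
      DPDA.reaches_iff_exists_stepN.2 ⟨n, (hstep n _).trans hn⟩
    rw [Set.mem_compl_iff, hM.mem_lang_iff_of_reaches hr, hM.acceptsFrom_iff_of_isHalting hc,
      hM'.mem_lang_iff_of_reaches hr', hM'.acceptsFrom_iff_of_isHalting ((hhalt _).2 hc)]
    exact ⟨hc.resolve_left, fun h h' => hM.1 _ h' h⟩

theorem DCFLInter.compl {α : Type} {d : ℕ} {L : Set (List α)} (hL : DCFLInter d L) :
    DCFLUnion d Lᶜ := by
  obtain ⟨f, hf, rfl⟩ := hL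
  exact ⟨fun i => (f i)ᶜ, fun i => (hf i).compl, Set.compl_iInter f⟩

/-- A family of finitely many languages that covers a dense language contains a member that is
dense above some word. -/
theorem exists_dense_above {α ι : Type} [Finite ι] (f : ι → Set (List α)) (w : List α)
    (hf : ∀ u, ∃ z i, w ++ u ++ z ∈ f i) : ∃ i u, ∀ v, ∃ z, w ++ u ++ v ++ z ∈ f i := by
  by_contra! h
  have key : ∀ S : Set ι, S.Finite → ∃ u, ∀ i ∈ S, ∀ z, w ++ u ++ z ∉ f i := by
    intro S hS
    induction S, hS using Set.Finite.induction_on with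
    | empty => exact ⟨[], by simp⟩
    | @insert i S _ _ ih =>
      obtain ⟨u, hu⟩ := ih
      obtain ⟨v, hv⟩ := h i u
      refine ⟨u ++ v, ?_⟩
      rintro j (rfl | hj) z
      · simpa using hv z
      · simpa using hu j hj (v ++ z)
  obtain ⟨u, hu⟩ := key Set.univ Set.finite_univ
  obtain ⟨z, i, hz⟩ := hf u
  exact hu i trivial z hz

/-- A language that coincides with the palindromes above some word `w` is not a finite union of
dcf languages. -/
theorem not_DCFLUnion_of_append_mem_iff {L : Set (List Bool)} {w : List Bool}
    (hL : ∀ v, w ++ v ∈ L ↔ v.Palindrome) (d : ℕ) : ¬ DCFLUnion d L := by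
  rintro ⟨f, hf, rfl⟩
  obtain ⟨i, u, hu⟩ := exists_dense_above f w fun u => by
    have h := (hL (u ++ u.reverse)).2 (List.Palindrome.of_reverse_eq (by simp))
    exact ⟨u.reverse, by simpa using h⟩
  obtain ⟨T, _, R, hR, hcof⟩ := (hf i).exists_finite_cofinal
  choose v t hvt using fun k : ℕ => hcof (w ++ (u ++ List.replicate k true ++ [false]))
  obtain ⟨j, k, hjk, ht⟩ : ∃ j k, j < k ∧ t j = t k := by
    obtain ⟨j, k, hne, h⟩ := Finite.exists_ne_map_eq_of_infinite t
    rcases hne.lt_or_gt with hlt | hlt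
    exacts [⟨j, k, hlt, h⟩, ⟨k, j, hlt, h.symm⟩]
  set p : ℕ → List Bool := fun k => u ++ List.replicate k true ++ [false] ++ v k with hp
  have hvt : ∀ k, w ++ p k ∈ R (t k) := fun k => by simpa [hp] using hvt k
  obtain ⟨z, hz⟩ := hu (List.replicate j true ++ [false] ++ v j ++
    List.replicate ((p j).length + (p k).length) true)
  set y := List.replicate ((p j).length + (p k).length) true ++ z with hy
  have hpre : ∀ l, (p l).length ≤ y.length → w ++ p l ++ y ∈ f i → p l <+: y.reverse := by
    intro l hl hmem
    have h := (hL (p l ++ y)).1 (Set.mem_iUnion.2 ⟨i, by simpa using hmem⟩)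
    have h := h.reverse_eq
    rw [List.reverse_append] at h
    exact List.prefix_of_prefix_length_le (List.prefix_append _ y)
      (h ▸ List.prefix_append _ _) (by simpa using hl)
  have hj : w ++ p j ++ y ∈ f i := by simpa [hp, hy] using hz
  have hk : w ++ p k ++ y ∈ f i := hR _ _ (hvt j) _ (ht ▸ hvt k) _ hj
  have h₁ : (p j)[u.length + j]? = some false := by simp [hp]
  have h₂ : (p k)[u.length + j]? = some true := by
    simp [hp, List.getElem?_append, hjk]
  have hget : ∀ {s : List Bool} {n : ℕ} {b : Bool}, s <+: y.reverse → s[n]? = some b →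
      y.reverse[n]? = some b := by
    rintro s n b ⟨r, hr⟩ h
    rw [← hr, List.getElem?_append_left (List.getElem?_eq_some_iff.1 h).1, h]
  have hlen : (p j).length + (p k).length ≤ y.length := by simp [hy]
  have e₁ := hget (hpre j (le_of_add_le_left hlen) hj) h₁
  have e₂ := hget (hpre k (le_of_add_le_right hlen) hk) h₂
  simp [e₁] at e₂

/-- The language spelled out by a symbol when nonterminals stand for given languages. -/
def symbolLanguage {T N : Type} (V : N → Set (List T)) : Symbol T N → Language T
  | .terminal a => ({[a]} : Set (List T))
  | .nonterminal A => V A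

/-- The language spelled out by a sentential form whose nonterminals stand for given languages. -/
def formLanguage {T N : Type} (V : N → Set (List T)) (s : List (Symbol T N)) : Language T :=
  (s.map (symbolLanguage V)).prod

theorem formLanguage_append {T N : Type} (V : N → Set (List T)) (s t : List (Symbol T N)) :
    formLanguage V (s ++ t) = formLanguage V s * formLanguage V t := by
  simp [formLanguage]

theorem mem_formLanguage_nil {T N : Type} {V : N → Set (List T)} {w : List T} :
    w ∈ formLanguage V [] ↔ w = [] :=
  Iff.rfl

theorem mem_formLanguage_terminal_cons {T N : Type} {V : N → Set (List T)} {a : T}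
    {s : List (Symbol T N)} {w : List T} :
    w ∈ formLanguage V (.terminal a :: s) ↔ ∃ v ∈ formLanguage V s, w = a :: v := by
  simp only [formLanguage, List.map_cons, List.prod_cons, Language.mem_mul]
  constructor
  · rintro ⟨_, rfl, v, hv, rfl⟩
    exact ⟨v, hv, rfl⟩
  · rintro ⟨v, hv, rfl⟩
    exact ⟨[a], rfl, v, hv, rfl⟩

theorem mem_formLanguage_nonterminal_cons {T N : Type} {V : N → Set (List T)} {A : N}
    {s : List (Symbol T N)} {w : List T} :
    w ∈ formLanguage V (.nonterminal A :: s) ↔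
      ∃ u ∈ V A, ∃ v ∈ formLanguage V s, w = u ++ v := by
  simp only [eq_comm (a := w)]
  exact Language.mem_mul

theorem mem_formLanguage_map_terminal_iff {T N : Type} {V : N → Set (List T)} {v w : List T} :
    v ∈ formLanguage V (w.map .terminal) ↔ v = w := by
  induction w generalizing v with
  | nil => exact mem_formLanguage_nil
  | cons a w ih => simp [mem_formLanguage_terminal_cons, ih]

/-- Languages closed under the rules of a grammar contain what the nonterminals generate. -/
theorem formLanguage_le_of_derives {T : Type} {g : ContextFreeGrammar T} {V : g.NT → Set (List T)}
    (hV : ∀ r ∈ g.rules, ∀ w ∈ formLanguage V r.output, w ∈ V r.input) {s t : List (Symbol T g.NT)}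
    (h : g.Derives s t) : formLanguage V t ≤ formLanguage V s := by
  induction h with
  | refl => exact le_rfl
  | tail _ h ih =>
    obtain ⟨r, hr, h⟩ := h
    obtain ⟨p, q, rfl, rfl⟩ := h.exists_parts
    refine le_trans ?_ ih
    have hle : formLanguage V r.output ≤ formLanguage V [Symbol.nonterminal r.input] := by
      intro w hw
      exact mem_formLanguage_nonterminal_cons.2
        ⟨w, hV r hr w hw, [], mem_formLanguage_nil.2 rfl, by simp⟩
    simp only [formLanguage_append]
    gcongr

/-- Nonterminals of the grammars for marked palindromes and non-palindromes. -/
inductive PalNT : Type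
  | start : Bool → PalNT
  | pal : PalNT
  | nonpal : PalNT
  | all : PalNT
deriving DecidableEq

namespace PalNT

/-- The words marked by `b` that are palindromes after the mark, and those marked by `!b` that are
not; `start true` includes the empty word. -/
def lang : PalNT → Set (List Bool)
  | start b => {w | (w = [] ∧ b = true) ∨ ∃ c v, w = c :: v ∧ (c = b ↔ v.Palindrome)}
  | pal => {w | w.Palindrome}
  | nonpal => {w | ¬ w.Palindrome}
  | all => Set.univ

open Symbol in
/-- The rewrite rules generating `PalNT.lang`. -/
def rules : Finset (ContextFreeRule Bool PalNT) :=
  {⟨start true, []⟩, ⟨pal, []⟩, ⟨all, []⟩} ∪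
  (Finset.univ : Finset Bool).biUnion fun b =>
    {⟨start b, [terminal b, nonterminal pal]⟩,
     ⟨start b, [terminal (!b), nonterminal nonpal]⟩,
     ⟨pal, [terminal b]⟩,
     ⟨pal, [terminal b, nonterminal pal, terminal b]⟩,
     ⟨nonpal, [terminal b, nonterminal nonpal, terminal b]⟩,
     ⟨nonpal, [terminal b, nonterminal all, terminal (!b)]⟩,
     ⟨all, [terminal b, nonterminal all]⟩}

/-- The grammar with the rules `PalNT.rules` and initial nonterminal `A`. -/
def grammar (A : PalNT) : ContextFreeGrammar Bool := ⟨PalNT, A, rules⟩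

theorem palindrome_cons_append_iff (a b : Bool) (w : List Bool) :
    (a :: (w ++ [b])).Palindrome ↔ a = b ∧ w.Palindrome := by
  simp only [List.Palindrome.iff_reverse_eq, List.reverse_cons, List.reverse_append,
    List.reverse_nil, List.nil_append, List.cons_append, List.cons.injEq]
  constructor
  · rintro ⟨rfl, h⟩
    exact ⟨rfl, List.append_cancel_right h⟩
  · rintro ⟨rfl, h⟩
    exact ⟨rfl, by rw [h]⟩

open Symbol in
theorem mem_rules {r : ContextFreeRule Bool PalNT} :
    r ∈ rules ↔ (r = ⟨start true, []⟩ ∨ r = ⟨pal, []⟩ ∨ r = ⟨all, []⟩) ∨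
      ∃ b, r = ⟨start b, [terminal b, nonterminal pal]⟩ ∨
        r = ⟨start b, [terminal (!b), nonterminal nonpal]⟩ ∨
        r = ⟨pal, [terminal b]⟩ ∨
        r = ⟨pal, [terminal b, nonterminal pal, terminal b]⟩ ∨
        r = ⟨nonpal, [terminal b, nonterminal nonpal, terminal b]⟩ ∨
        r = ⟨nonpal, [terminal b, nonterminal all, terminal (!b)]⟩ ∨
        r = ⟨all, [terminal b, nonterminal all]⟩ := by
  simp only [rules, Finset.mem_union, Finset.mem_insert, Finset.mem_singleton, Finset.mem_biUnion,
    Finset.mem_univ, true_and]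

theorem mem_lang_of_mem_formLanguage {r : ContextFreeRule Bool PalNT} (hr : r ∈ rules)
    {w : List Bool} (hw : w ∈ formLanguage lang r.output) : w ∈ lang r.input := by
  rcases mem_rules.1 hr with (rfl | rfl | rfl) | ⟨b, rfl | rfl | rfl | rfl | rfl | rfl | rfl⟩ <;>
    simp only [mem_formLanguage_nil, mem_formLanguage_terminal_cons,
      mem_formLanguage_nonterminal_cons] at hw
  · exact Or.inl ⟨hw, rfl⟩
  · subst hw
    exact List.Palindrome.nil
  · trivial
  · obtain ⟨_, ⟨u, hu, _, rfl, rfl⟩, rfl⟩ := hw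
    exact Or.inr ⟨_, _, rfl, by simpa [lang] using hu⟩
  · obtain ⟨_, ⟨u, hu, _, rfl, rfl⟩, rfl⟩ := hw
    exact Or.inr ⟨_, _, rfl, by simpa [lang] using hu⟩
  · obtain ⟨_, rfl, rfl⟩ := hw
    exact List.Palindrome.singleton b
  · obtain ⟨_, ⟨u, hu, _, ⟨_, rfl, rfl⟩, rfl⟩, rfl⟩ := hw
    exact (palindrome_cons_append_iff b b u).2 ⟨rfl, hu⟩
  · obtain ⟨_, ⟨u, hu, _, ⟨_, rfl, rfl⟩, rfl⟩, rfl⟩ := hw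
    exact fun h => hu ((palindrome_cons_append_iff b b u).1 h).2
  · obtain ⟨_, ⟨u, hu, _, ⟨_, rfl, rfl⟩, rfl⟩, rfl⟩ := hw
    exact fun h => by simpa using ((palindrome_cons_append_iff b (!b) u).1 h).1
  · trivial

section Derivations

variable {A₀ A B : PalNT} {w : List Bool}

/-- The grammar derives the word `w` from the nonterminal `A`. -/
def DerivesWord (A₀ A : PalNT) (w : List Bool) : Prop :=
  (grammar A₀).Derives [.nonterminal A] (w.map .terminal)

theorem DerivesWord.of_rule_terminal (h : ⟨A, w.map .terminal⟩ ∈ rules) : DerivesWord A₀ A w :=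
  ContextFreeGrammar.Produces.single ⟨_, h, ContextFreeRule.Rewrites.input_output⟩

theorem DerivesWord.of_rule {x y : List Bool}
    (h : ⟨A, x.map .terminal ++ [.nonterminal B] ++ y.map .terminal⟩ ∈ rules)
    (hw : DerivesWord A₀ B w) : DerivesWord A₀ A (x ++ w ++ y) := by
  have h₁ : (grammar A₀).Produces [.nonterminal A]
      (x.map .terminal ++ [.nonterminal B] ++ y.map .terminal) :=
    ⟨_, h, ContextFreeRule.Rewrites.input_output⟩
  have h₂ := (ContextFreeGrammar.Derives.append_left hw (x.map .terminal)).append_right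
    (y.map .terminal)
  unfold DerivesWord
  simp only [List.map_append]
  exact h₁.trans_derives h₂

theorem derivesWord_all (w : List Bool) : DerivesWord A₀ all w := by
  induction w with
  | nil => exact .of_rule_terminal (mem_rules.2 (by simp))
  | cons a w ih =>
    simpa using DerivesWord.of_rule (A := all) (x := [a]) (y := [])
      (mem_rules.2 (Or.inr ⟨a, by simp⟩)) ih

theorem derivesWord_pal (h : w.Palindrome) : DerivesWord A₀ pal w := by
  induction h with
  | nil => exact .of_rule_terminal (mem_rules.2 (by simp))
  | singleton a => exact .of_rule_terminal (mem_rules.2 (Or.inr ⟨a, by simp⟩))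
  | cons_concat a _ ih =>
    exact .of_rule (x := [a]) (y := [a]) (mem_rules.2 (Or.inr ⟨a, by simp⟩)) ih

theorem derivesWord_nonpal (h : ¬ w.Palindrome) : DerivesWord A₀ nonpal w := by
  induction w using List.bidirectionalRec with
  | nil => exact (h .nil).elim
  | singleton a => exact (h (.singleton a)).elim
  | cons_append a w b ih =>
    rw [palindrome_cons_append_iff] at h
    by_cases hab : b = a
    · subst hab
      exact .of_rule (x := [b]) (y := [b]) (mem_rules.2 (Or.inr ⟨b, by simp⟩))
        (ih fun hw => h ⟨rfl, hw⟩)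
    · obtain rfl : b = !a := by cases a <;> cases b <;> simp_all
      exact .of_rule (x := [a]) (y := [!a]) (mem_rules.2 (Or.inr ⟨a, by simp⟩)) (derivesWord_all w)

theorem derivesWord_start {b : Bool} (h : w ∈ lang (start b)) : DerivesWord A₀ (start b) w := by
  rcases h with ⟨rfl, rfl⟩ | ⟨c, v, rfl, h⟩
  · exact .of_rule_terminal (mem_rules.2 (by simp))
  · by_cases hc : c = b
    · subst hc
      simpa using DerivesWord.of_rule (A := start c) (x := [c]) (y := [])
        (mem_rules.2 (Or.inr ⟨c, by simp⟩)) (derivesWord_pal (h.1 rfl))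
    · obtain rfl : c = !b := by cases c <;> cases b <;> simp_all
      simpa using DerivesWord.of_rule (A := start b) (x := [!b]) (y := [])
        (mem_rules.2 (Or.inr ⟨b, by simp⟩)) (derivesWord_nonpal (mt h.2 hc))

end Derivations

theorem isContextFree_lang_start (b : Bool) :
    Language.IsContextFree (lang (start b) : Language Bool) := by
  refine ⟨grammar (start b), Set.ext fun w => ⟨fun h => ?_, derivesWord_start⟩⟩
  have hle := formLanguage_le_of_derives (g := grammar (start b)) (V := lang)
    (fun _ hr _ => mem_lang_of_mem_formLanguage hr) h
  have hw := hle (mem_formLanguage_map_terminal_iff.2 rfl)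
  obtain ⟨u, hu, _, rfl, rfl⟩ := mem_formLanguage_nonterminal_cons.1 hw
  rwa [List.append_nil]

theorem mem_lang_start_iff {b : Bool} {w : List Bool} :
    w ∈ lang (start b) ↔ (w = [] ∧ b = true) ∨ ∃ c v, w = c :: v ∧ (c = b ↔ v.Palindrome) :=
  Iff.rfl

theorem compl_lang_start_false :
    (lang (start false))ᶜ = lang (start true) := by
  ext w
  change ¬ w ∈ lang (start false) ↔ w ∈ lang (start true)
  rcases w with _ | ⟨c, v⟩
  · simp [mem_lang_start_iff]
  · cases c <;> simp [mem_lang_start_iff]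

theorem append_mem_lang_start_iff (b : Bool) (v : List Bool) :
    [b] ++ v ∈ lang (start b) ↔ v.Palindrome := by
  cases b <;> simp [mem_lang_start_iff]

end PalNT

/-- `CFL ∩ co-CFL ⊄ DCFL(ω) ∪ DCFL[ω]`: there is a language `L` such that both
`L` and its complement are context-free, yet `L` is in no `DCFL(d)` and in no
`DCFL[d]`. -/
theorem CFL_cap_coCFL_not_subset_DCFLInter_union_DCFLUnion :
    ∃ (α : Type) (L : Set (List α)),
      Language.IsContextFree (L : Language α) ∧
      Language.IsContextFree ((Lᶜ : Set (List α)) : Language α) ∧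
      ∀ d : ℕ, 1 ≤ d → ¬ DCFLInter d L ∧ ¬ DCFLUnion d L := by
  refine ⟨Bool, PalNT.lang (.start false), PalNT.isContextFree_lang_start false, ?_,
    fun d _ => ⟨fun h => ?_, ?_⟩⟩
  · rw [PalNT.compl_lang_start_false]
    exact PalNT.isContextFree_lang_start true
  · have h := h.compl
    rw [PalNT.compl_lang_start_false] at h
    exact not_DCFLUnion_of_append_mem_iff (PalNT.append_mem_lang_start_iff true) d h
  · exact not_DCFLUnion_of_append_mem_iff (PalNT.append_mem_lang_start_iff false) d

end DCFLFormal
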